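/- Let L be a frame and let f satisfy relations (r1), (r3), (r4) and the Hausdorff conditions (f(r,—)* ≤ f(—,s) and f(—,s)* ≤ f(r,—) for r < s). Then for all s ∈ ℚ: f(—,s) = ⋁_{q<s} f(q,—)* = ⋁_{q<s} f(—,q)**. -/

import Mathlib

/-- `HausdorffFn fr fs` : the family `(fr r, fs s)` indexed by rationals
satisfies relations (r1), (r3), (r4) and the Hausdorff conditions. -/
def HausdorffFn {L : Type*} [Order.Frame L] (fr fs : ℚ → L) : Prop :=
  (∀ r s : ℚ, s ≤ r → fr r ⊓ fs s = ⊥) ∧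
  (∀ r : ℚ, fr r = ⨆ p > r, fr p) ∧
  (∀ s : ℚ, fs s = ⨆ q < s, fs q) ∧
  (∀ r s : ℚ, r < s → (fr r)ᶜ ≤ fs s) ∧
  (∀ r s : ℚ, r < s → (fs s)ᶜ ≤ fr r)

/-- For a Hausdorff function `f` on a frame `L`,
`f(—,s) = ⋁_{q<s} f(q,—)* = ⋁_{q<s} f(—,q)**`. -/
theorem stmt_12 {L : Type*} [Order.Frame L] (fr fs : ℚ → L)
    (hf : HausdorffFn fr fs) :
    ∀ s : ℚ, fs s = (⨆ q < s, (fr q)ᶜ) ∧ fs s = ⨆ q < s, (fs q)ᶜᶜ := by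
  obtain ⟨disj, -, hfs, compl_fr_le, -⟩ := hf
  have le_compl (q : ℚ) : fs q ≤ (fr q)ᶜ :=
    le_compl_iff_disjoint_left.2 (disjoint_iff.2 (disj q q le_rfl))
  have compl_compl_le (q : ℚ) : (fs q)ᶜᶜ ≤ (fr q)ᶜ := by
    simpa only [compl_compl_compl] using compl_le_compl (compl_le_compl (le_compl q))
  refine fun s => ⟨le_antisymm ?_ (iSup₂_le fun q hq => compl_fr_le q s hq),
    le_antisymm ?_ (iSup₂_le fun q hq => (compl_compl_le q).trans (compl_fr_le q s hq))⟩
  · exact (hfs s).trans_le (iSup₂_mono fun q _ => le_compl q)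
  · exact (hfs s).trans_le (iSup₂_mono fun q _ => le_compl_compl)
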